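/- arXiv:2512.06672 — 2 statements merged into one kernel-verified Lean document; each statement's English description precedes it below -/
import Mathlib

section
/- Let m = a + b + 1 ≥ 2 with a, b nonnegative integers, n ≥ 2, and ζ = exp(2πi/n). With u_k = 1/(1-ζ^k), define P(a,b) = Σ_{1≤i₁<…<i_m≤n-1} u_{i₁}⋯u_{i_a}·u_{i_{a+1}}²·u_{i_{a+2}}⋯u_{i_m} (the exponent 2 at position a+1, exponent 1 elsewhere). Then P(a,b) + P(b,a) = -(m!·(n-2m-3)/(m+2)!)·C(n-1,m). -/
open Complex Finset
open scoped Classical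

/-- The sum of `∏ r, w r (i r)` over all tuples `1 ≤ i 0 < ⋯ < i (m - 1) ≤ N`. -/
noncomputable def strictMonoSum (w : ℕ → ℕ → ℂ) (m N : ℕ) : ℂ :=
  ∑ i ∈ (Fintype.piFinset fun _ : Fin m => Finset.Icc 1 N).filter (fun i => StrictMono i),
    ∏ r : Fin m, w r (i r)

lemma strictMonoSum_zero_left (w : ℕ → ℕ → ℂ) (N : ℕ) : strictMonoSum w 0 N = 1 := by
  have h : ∀ i : Fin 0 → ℕ, StrictMono i := fun i a => a.elim0
  simp [strictMonoSum, h]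

lemma strictMonoSum_zero_right (w : ℕ → ℕ → ℂ) (m : ℕ) : strictMonoSum w (m + 1) 0 = 0 := by
  simp [strictMonoSum]

lemma strictMono_snoc_iff {m : ℕ} (i : Fin m → ℕ) (k : ℕ) :
    StrictMono (Fin.snoc i k : Fin (m + 1) → ℕ) ↔ StrictMono i ∧ ∀ r, i r < k := by
  refine ⟨fun h => ⟨fun r s hrs => ?_, fun r => ?_⟩, fun h r s hrs => ?_⟩
  · simpa using h (Fin.castSucc_lt_castSucc_iff.2 hrs)
  · simpa using h (Fin.castSucc_lt_last r)
  · induction s using Fin.lastCases with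
    | last =>
      induction r using Fin.lastCases with
      | last => exact absurd hrs (lt_irrefl _)
      | cast r => simpa using h.2 r
    | cast s =>
      induction r using Fin.lastCases with
      | last => exact absurd hrs (Fin.castSucc_lt_last s).not_gt
      | cast r => simpa using h.1 (Fin.castSucc_lt_castSucc_iff.1 hrs)

lemma strictMonoSum_succ (w : ℕ → ℕ → ℂ) (m N : ℕ) :
    strictMonoSum w (m + 1) (N + 1) =
      strictMonoSum w (m + 1) N + w m (N + 1) * strictMonoSum w m N := by
  unfold strictMonoSum
  rw [← sum_filter_not_add_sum_filter _ (fun i : Fin (m + 1) → ℕ => i (Fin.last m) = N + 1)]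
  congr 1
  · refine sum_congr (ext fun i => ?_) fun _ _ => rfl
    simp only [mem_filter, Fintype.mem_piFinset, mem_Icc]
    refine ⟨fun ⟨⟨hi, hm⟩, hl⟩ => ⟨fun r => ⟨(hi r).1, ?_⟩, hm⟩,
      fun ⟨hi, hm⟩ => ⟨⟨fun r => ⟨(hi r).1, (hi r).2.trans N.le_succ⟩, hm⟩, ?_⟩⟩
    · have h1 := hm.monotone (Fin.le_last r)
      have h2 := (hi (Fin.last m)).2
      omega
    · have := (hi (Fin.last m)).2
      omega
  · rw [mul_sum]
    refine sum_bij' (fun i _ => Fin.init i) (fun i _ => Fin.snoc i (N + 1)) ?_ ?_ ?_ ?_ ?_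
    · intro i
      induction i using Fin.snocCases with | snoc i k => ?_
      simp only [mem_filter, Fintype.mem_piFinset, mem_Icc, strictMono_snoc_iff, Fin.init_snoc,
        Fin.snoc_last]
      rintro ⟨⟨hi, hm, hk⟩, rfl⟩
      exact ⟨fun r => ⟨by simpa using (hi r.castSucc).1, Nat.lt_succ_iff.1 (hk r)⟩, hm⟩
    · intro i
      simp only [mem_filter, Fintype.mem_piFinset, mem_Icc, strictMono_snoc_iff, Fin.snoc_last]
      rintro ⟨hi, hm⟩
      refine ⟨⟨fun r => ?_, hm, fun r => Nat.lt_succ_iff.2 (hi r).2⟩, trivial⟩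
      induction r using Fin.lastCases with
      | last => simp
      | cast r => simpa using ⟨(hi r).1, (hi r).2.trans N.le_succ⟩
    · intro i hi
      rw [← (mem_filter.1 hi).2, Fin.snoc_init_self]
    · intro i _
      exact Fin.init_snoc _ _
    · intro i hi
      rw [Fin.prod_univ_castSucc, (mem_filter.1 hi).2, mul_comm]
      rfl

open Polynomial in
lemma coeff_succ_mul_one_add (p : ℂ[X]) (c : ℂ) (m : ℕ) :
    (p * (1 + C c * X)).coeff (m + 1) = p.coeff (m + 1) + c * p.coeff m := by
  rw [mul_add, mul_one, coeff_add, mul_left_comm, coeff_C_mul, coeff_mul_X]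

open Polynomial in
lemma coeff_zero_prod_one_add (u : ℕ → ℂ) (s : Finset ℕ) :
    (∏ i ∈ s, (1 + C (u i) * X)).coeff 0 = 1 := by
  simp [coeff_zero_eq_eval_zero, eval_prod]

open Polynomial in
lemma strictMonoSum_eq_coeff (u : ℕ → ℂ) (a m N : ℕ) (hm : m ≤ a) :
    strictMonoSum (fun r k => u k ^ (if r = a then 2 else 1)) m N =
      (∏ i ∈ Ico 1 (N + 1), (1 + C (u i) * X)).coeff m := by
  induction N generalizing m with
  | zero =>
    cases m with
    | zero => simp [strictMonoSum_zero_left]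
    | succ m => simp [strictMonoSum_zero_right, coeff_one]
  | succ N ih =>
    cases m with
    | zero => rw [strictMonoSum_zero_left, coeff_zero_prod_one_add]
    | succ m =>
      rw [strictMonoSum_succ, ih _ hm, ih _ (by omega), prod_Ico_succ_top (by omega : 1 ≤ N + 1),
        coeff_succ_mul_one_add, if_neg (by omega), pow_one]

open Polynomial in
lemma strictMonoSum_eq_sum_coeff (u : ℕ → ℂ) (a b N : ℕ) :
    strictMonoSum (fun r k => u k ^ (if r = a then 2 else 1)) (a + b + 1) N =
      ∑ k ∈ Ico 1 (N + 1), u k ^ 2 * (∏ i ∈ Ico 1 k, (1 + C (u i) * X)).coeff a *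
        (∏ i ∈ Ico (k + 1) (N + 1), (1 + C (u i) * X)).coeff b := by
  induction N generalizing b with
  | zero => simp [strictMonoSum_zero_right]
  | succ N ih =>
    rw [strictMonoSum_succ, ih, sum_Ico_succ_top (by omega : 1 ≤ N + 1)]
    cases b with
    | zero =>
      simp only [coeff_zero_prod_one_add]
      rw [add_zero, strictMonoSum_eq_coeff u a a N le_rfl, if_pos rfl, mul_one]
    | succ b =>
      rw [← add_assoc, ih, if_neg (by omega), pow_one, Ico_self, prod_empty, coeff_one,
        if_neg (by omega), mul_zero, add_zero, mul_sum, ← sum_add_distrib]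
      refine sum_congr rfl fun k hk => ?_
      rw [prod_Ico_succ_top (by have := mem_Ico.1 hk; omega : k + 1 ≤ N + 1) fun i => 1 + C (u i) * X,
        coeff_succ_mul_one_add]
      ring

open Polynomial in
lemma exists_coeff_eq_sum_eval (x : ℕ → ℂ) (s : Finset ℕ) (hx : Set.InjOn x s) (a : ℕ) :
    ∃ L : ℕ → ℂ, ∀ p : ℂ[X], p.degree < #s → p.coeff a = ∑ r ∈ s, L r * p.eval (x r) := by
  refine ⟨fun r => (Lagrange.basis s x r).coeff a, fun p hp => ?_⟩
  conv_lhs => rw [Lagrange.eq_interpolate hx hp, Lagrange.interpolate_apply, finsetSum_coeff]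
  exact sum_congr rfl fun r _ => by rw [coeff_C_mul, mul_comm]

open Polynomial in
/-- Bilinear expressions in polynomials of small degree that agree on a grid have the same
coefficients. -/
lemma sum_coeff_mul_coeff_eq {ι κ : Type*} (x : ℕ → ℂ) (s : Finset ℕ) (hx : Set.InjOn x s)
    (I : Finset ι) (J : Finset κ) (p q : ι → ℂ[X]) (f g : κ → ℂ[X])
    (hp : ∀ i ∈ I, (p i).degree < #s) (hq : ∀ i ∈ I, (q i).degree < #s)
    (hf : ∀ j ∈ J, (f j).degree < #s) (hg : ∀ j ∈ J, (g j).degree < #s)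
    (h : ∀ r ∈ s, ∀ t ∈ s,
      ∑ i ∈ I, ((p i).eval (x r) * (q i).eval (x t) + (p i).eval (x t) * (q i).eval (x r)) =
        ∑ j ∈ J, (f j).eval (x r) * (g j).eval (x t)) (a b : ℕ) :
    ∑ i ∈ I, ((p i).coeff a * (q i).coeff b + (p i).coeff b * (q i).coeff a) =
      ∑ j ∈ J, (f j).coeff a * (g j).coeff b := by
  obtain ⟨L, hL⟩ := exists_coeff_eq_sum_eval x s hx a
  obtain ⟨M, hM⟩ := exists_coeff_eq_sum_eval x s hx b
  have key (P Q : ℂ[X]) (hP : P.degree < #s) (hQ : Q.degree < #s) :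
      P.coeff a * Q.coeff b =
        ∑ r ∈ s, ∑ t ∈ s, L r * M t * (P.eval (x r) * Q.eval (x t)) := by
    rw [hL P hP, hM Q hQ, sum_mul_sum]
    exact sum_congr rfl fun r _ => sum_congr rfl fun t _ => by ring
  have hl : ∀ i ∈ I, (p i).coeff a * (q i).coeff b + (p i).coeff b * (q i).coeff a =
      ∑ r ∈ s, ∑ t ∈ s, L r * M t *
        ((p i).eval (x r) * (q i).eval (x t) + (p i).eval (x t) * (q i).eval (x r)) := by
    intro i hi
    rw [mul_comm ((p i).coeff b), key _ _ (hp i hi) (hq i hi), key _ _ (hq i hi) (hp i hi),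
      ← sum_add_distrib]
    refine sum_congr rfl fun r _ => ?_
    rw [← sum_add_distrib]
    exact sum_congr rfl fun t _ => by ring
  rw [sum_congr rfl hl, sum_congr rfl fun j hj => key _ _ (hf j hj) (hg j hj), sum_comm,
    sum_comm (s := J)]
  refine sum_congr rfl fun r hr => ?_
  rw [sum_comm, sum_comm (s := J)]
  refine sum_congr rfl fun t ht => ?_
  rw [← mul_sum, ← mul_sum, h r hr t ht]

lemma prod_pow_sub_pow {R : Type*} [CommRing R] (q : R) {r s : ℕ} (hrs : r ≤ s) :
    ∏ i ∈ Ico 1 r, (q ^ s - q ^ i) =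
      (∏ i ∈ Ico 1 r, -q ^ i) * ∏ j ∈ Ico (s + 1 - r) s, (1 - q ^ j) := by
  have h := prod_Ico_reflect (fun j => 1 - q ^ j) 1 (show r ≤ s + 1 by omega)
  rw [show s + 1 - 1 = s by omega] at h
  rw [← h, ← prod_mul_distrib]
  refine prod_congr rfl fun i hi => ?_
  have := mem_Ico.1 hi
  rw [mul_sub, neg_mul, neg_mul, ← pow_add, show i + (s - i) = s by omega]
  ring

lemma prod_pow_sub_pow_mul_prod_one_sub {R : Type*} [CommRing R] (q : R) {r s : ℕ} (hr : 1 ≤ r)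
    (hrs : r ≤ s) :
    (∏ i ∈ Ico 1 r, (q ^ s - q ^ i)) * ∏ j ∈ Ico 1 (s + 1 - r), (1 - q ^ j) =
      (∏ i ∈ Ico 1 r, (q ^ r - q ^ i)) * ∏ j ∈ Ico r s, (1 - q ^ j) := by
  rw [prod_pow_sub_pow q hrs, prod_pow_sub_pow q le_rfl, show r + 1 - r = 1 by omega, mul_assoc,
    mul_assoc, mul_comm (∏ j ∈ Ico (s + 1 - r) s, (1 - q ^ j)),
    prod_Ico_consecutive _ (by omega) (by omega), prod_Ico_consecutive _ (by omega) (by omega)]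

lemma prod_Ico_pow_sub_pow {R : Type*} [CommRing R] (q : R) (r l : ℕ) :
    ∏ j ∈ Ico (r + 1) (r + l), (q ^ r - q ^ j) =
      q ^ (r * (l - 1)) * ∏ j ∈ Ico 1 l, (1 - q ^ j) := by
  have h := prod_Ico_add (fun j => q ^ r - q ^ j) 1 l r
  rw [add_comm 1, add_comm l] at h
  rw [← h, pow_mul, ← Nat.card_Ico, ← prod_const, ← prod_mul_distrib]
  exact prod_congr rfl fun j _ => by rw [pow_add]; ring

/-- The product of the differences between `q ^ k` and the other `q ^ j`, `r ≤ j ≤ s`, for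
consecutive values of `k`. -/
lemma prod_pow_sub_pow_succ {R : Type*} [CommRing R] (q : R) {r s k : ℕ} (hr : r ≤ k) (hk : k < s) :
    q * (q ^ k - q ^ s) * ((∏ j ∈ Ico r (k + 1), (q ^ (k + 1) - q ^ j)) *
        ∏ j ∈ Ico (k + 2) (s + 1), (q ^ (k + 1) - q ^ j)) =
      q ^ (s - r) * (q ^ (k + 1) - q ^ r) * ((∏ j ∈ Ico r k, (q ^ k - q ^ j)) *
        ∏ j ∈ Ico (k + 1) (s + 1), (q ^ k - q ^ j)) := by
  have shift (a b : ℕ) : ∏ j ∈ Ico (a + 1) (b + 1), (q ^ (k + 1) - q ^ j) =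
      q ^ (b - a) * ∏ j ∈ Ico a b, (q ^ k - q ^ j) := by
    rw [← prod_Ico_add' (fun j => q ^ (k + 1) - q ^ j), ← Nat.card_Ico, ← prod_const,
      ← prod_mul_distrib]
    exact prod_congr rfl fun j _ => by ring
  rw [prod_eq_prod_Ico_succ_bot (by omega : r < k + 1), shift, shift,
    prod_Ico_succ_top (by omega : k + 1 ≤ s),
    show s - r = (k - r) + (s - (k + 1)) + 1 by omega]
  ring

section
variable {n : ℕ} {ζ : ℂ}

lemma prod_Ico_one_sub_pow (hζ : IsPrimitiveRoot ζ n) (hn : 1 ≤ n) :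
    ∏ i ∈ Ico 1 n, (1 - ζ ^ i) = n := by
  obtain ⟨m, rfl⟩ := Nat.exists_eq_add_of_le' hn
  rw [← prod_Ico_add' (fun i => 1 - ζ ^ i) 0 m 1, ← range_eq_Ico,
    hζ.prod_one_sub_pow_eq_order]
  push_cast
  rfl

lemma one_sub_pow_ne_zero (hζ : IsPrimitiveRoot ζ n) {k : ℕ} (hk : 1 ≤ k) (hkn : k < n) :
    1 - ζ ^ k ≠ 0 :=
  sub_ne_zero.2 (hζ.pow_ne_one_of_pos_of_lt (by omega) hkn).symm

lemma pow_mul_prod_pow_sub_pow (hζ : IsPrimitiveRoot ζ n) {r : ℕ} (hr : 1 ≤ r) (hrn : r < n) :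
    ζ ^ r * (ζ ^ r - 1) *
      ((∏ i ∈ Ico 1 r, (ζ ^ r - ζ ^ i)) * ∏ i ∈ Ico (r + 1) n, (ζ ^ r - ζ ^ i)) = n := by
  obtain ⟨l, rfl⟩ := Nat.exists_eq_add_of_lt hrn
  have h1 : ∏ i ∈ Ico 1 r, (ζ ^ r - ζ ^ i) =
      ζ ^ (r * (r - 1)) * ∏ j ∈ Ico (1 + (l + 1)) (r + (l + 1)), (1 - ζ ^ j) := by
    rw [← prod_Ico_add' (fun j => 1 - ζ ^ j), pow_mul, ← Nat.card_Ico, ← prod_const,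
      ← prod_mul_distrib]
    refine prod_congr rfl fun i _ => ?_
    rw [mul_sub, ← pow_add, show r + (i + (l + 1)) = i + (r + l + 1) by ring, pow_add _ i,
      hζ.pow_eq_one]
    ring
  have h2 : ζ ^ r * (ζ ^ r - 1) = ζ ^ (2 * r) * (1 - ζ ^ (l + 1)) := by
    have : ζ ^ r * ζ ^ (l + 1) = 1 := by rw [← pow_add, ← add_assoc, hζ.pow_eq_one]
    linear_combination ζ ^ r * this
  have h3 := prod_Ico_one_sub_pow hζ (by omega)
  rw [← prod_Ico_consecutive _ (by omega : 1 ≤ 1 + (l + 1)) (by omega), ← add_assoc 1 l,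
    prod_Ico_succ_top (by omega), add_comm 1 l] at h3
  have h4 : ζ ^ (2 * r) * ζ ^ (r * (r - 1)) * ζ ^ (r * l) = 1 := by
    obtain ⟨r, rfl⟩ := Nat.exists_eq_add_of_le' hr
    rw [← pow_add, ← pow_add, Nat.add_sub_cancel,
      show 2 * (r + 1) + (r + 1) * r + (r + 1) * l = (r + 1 + l + 1) * (r + 1) by ring, pow_mul,
      hζ.pow_eq_one, one_pow]
  rw [h2, h1, add_assoc r l 1, prod_Ico_pow_sub_pow, Nat.add_sub_cancel, ← add_assoc r l 1, ← h3,
    show 1 + (l + 1) = l + 1 + 1 by ring]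
  linear_combination (1 - ζ ^ (l + 1)) * (∏ j ∈ Ico (l + 1 + 1) (r + l + 1), (1 - ζ ^ j)) *
    (∏ j ∈ Ico 1 (l + 1), (1 - ζ ^ j)) * h4

lemma prod_mul_prod_eq (hζ : IsPrimitiveRoot ζ n) {r s k : ℕ} (hr : 1 ≤ r) (hrs : r < s)
    (hs : s < n) (hk : r ≤ k) (hks : k ≤ s) :
    ((∏ i ∈ Ico 1 k, (ζ ^ s - ζ ^ i)) * ∏ i ∈ Ico (k + 1) n, (ζ ^ r - ζ ^ i)) *
      ((∏ j ∈ Ico r k, (ζ ^ k - ζ ^ j)) * ∏ j ∈ Ico (k + 1) (s + 1), (ζ ^ k - ζ ^ j)) =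
    -n * (∏ j ∈ Ico (r + 1) s, (1 - ζ ^ j)) * (ζ ^ k) ^ (s - r - 1) := by
  have h0 : ζ ≠ 0 := hζ.ne_zero (by omega)
  induction k, hk using Nat.le_induction with
  | base =>
    rw [Ico_self, prod_empty, one_mul]
    have h1 := pow_mul_prod_pow_sub_pow hζ hr (by omega)
    have h2 := prod_pow_sub_pow_mul_prod_one_sub ζ hr hrs.le
    have h3 := prod_Ico_pow_sub_pow ζ r (s + 1 - r)
    rw [show r + (s + 1 - r) = s + 1 by omega, show s + 1 - r - 1 = s - r - 1 + 1 by omega,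
      pow_mul, pow_succ] at h3
    rw [prod_eq_prod_Ico_succ_bot hrs] at h2
    have h4 := one_sub_pow_ne_zero hζ hr (by omega)
    rw [h3]
    linear_combination (∏ i ∈ Ico (r + 1) n, (ζ ^ r - ζ ^ i)) * (ζ ^ r) ^ (s - r - 1) * ζ ^ r * h2
      - (∏ j ∈ Ico (r + 1) s, (1 - ζ ^ j)) * (ζ ^ r) ^ (s - r - 1) * h1
  | succ k hk ih =>
    specialize ih (by omega)
    have hW := prod_pow_sub_pow_succ ζ hk (by omega : k < s)
    have hinj {i j : ℕ} (hi : i < n) (hj : j < n) (h : i ≠ j) : ζ ^ i - ζ ^ j ≠ 0 :=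
      sub_ne_zero.2 fun e => h (hζ.pow_inj hi hj e)
    have h1 := hinj (by omega : k < n) hs (by omega)
    have h2 := hinj (by omega : k + 1 < n) (by omega : r < n) (by omega)
    rw [prod_eq_prod_Ico_succ_bot (by omega : k + 1 < n)] at ih
    rw [prod_Ico_succ_top (by omega)]
    obtain ⟨d, hd⟩ := Nat.exists_eq_add_of_lt hrs
    rw [show s - r - 1 = d by omega] at *
    rw [show s - r = d + 1 by omega] at hW
    refine mul_left_cancel₀ (mul_ne_zero h0 (mul_ne_zero h1 h2)) ?_
    linear_combination (ζ ^ (k + 1) - ζ ^ r) * (∏ i ∈ Ico 1 k, (ζ ^ s - ζ ^ i)) * (ζ ^ s - ζ ^ k) *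
      (∏ i ∈ Ico (k + 1 + 1) n, (ζ ^ r - ζ ^ i)) * hW +
      ζ ^ (d + 1) * (ζ ^ (k + 1) - ζ ^ r) * (ζ ^ k - ζ ^ s) * ih

lemma sum_prod_mul_prod_mul_inv (hζ : IsPrimitiveRoot ζ n) {r s : ℕ} (hr : 1 ≤ r) (hrs : r < s)
    (hs : s < n) :
    ∑ k ∈ Ico r (s + 1), (1 - ζ ^ k)⁻¹ *
      ((∏ i ∈ Ico 1 k, (ζ ^ s - ζ ^ i)) * ∏ i ∈ Ico (k + 1) n, (ζ ^ r - ζ ^ i)) =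
    -n * ((1 - ζ ^ r)⁻¹ * (1 - ζ ^ s)⁻¹) := by
  have hinj : Set.InjOn (fun k => ζ ^ k) (Ico r (s + 1) : Finset ℕ) := fun i hi j hj h => by
    have hi := mem_Ico.1 (mem_coe.1 hi)
    have hj := mem_Ico.1 (mem_coe.1 hj)
    exact hζ.pow_inj (by omega) (by omega) h
  have hne {k : ℕ} (hk : k ∈ Ico r (s + 1)) : 1 - ζ ^ k ≠ 0 := by
    have := mem_Ico.1 hk
    exact one_sub_pow_ne_zero hζ (by omega) (by omega)
  have h1 := Lagrange.eval_interpolate_not_at_node (x := 1) (v := fun k => ζ ^ k)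
    (s := Ico r (s + 1)) (fun k => (ζ ^ k) ^ (s - r - 1)) fun k hk => sub_ne_zero.1 (hne hk)
  have h2 := Lagrange.eq_interpolate (f := (Polynomial.X : Polynomial ℂ) ^ (s - r - 1)) hinj (by
    rw [Polynomial.degree_X_pow, Nat.card_Ico]
    exact_mod_cast (by omega : s - r - 1 < s + 1 - r))
  simp only [Polynomial.eval_pow, Polynomial.eval_X] at h2
  rw [← h2, Polynomial.eval_pow, Polynomial.eval_X, one_pow, Lagrange.eval_nodal,
    prod_Ico_succ_top hrs.le, prod_eq_prod_Ico_succ_bot hrs] at h1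
  have h3 : ∀ k ∈ Ico r (s + 1), (1 - ζ ^ k)⁻¹ *
      ((∏ i ∈ Ico 1 k, (ζ ^ s - ζ ^ i)) * ∏ i ∈ Ico (k + 1) n, (ζ ^ r - ζ ^ i)) =
      -n * (∏ j ∈ Ico (r + 1) s, (1 - ζ ^ j)) *
        (Lagrange.nodalWeight (Ico r (s + 1)) (fun k => ζ ^ k) k * (1 - ζ ^ k)⁻¹ *
          (ζ ^ k) ^ (s - r - 1)) := by
    intro k hk
    have hk' := mem_Ico.1 hk
    have h4 := prod_mul_prod_eq hζ hr hrs hs hk'.1 (by omega)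
    have h5 : (∏ j ∈ Ico r k, (ζ ^ k - ζ ^ j)) * ∏ j ∈ Ico (k + 1) (s + 1), (ζ ^ k - ζ ^ j) =
        ∏ j ∈ (Ico r (s + 1)).erase k, (ζ ^ k - ζ ^ j) := by
      rw [← prod_union (disjoint_left.2 fun j hj hj' => by simp at hj hj'; omega)]
      refine prod_congr (ext fun j => ?_) fun _ _ => rfl
      simp only [mem_union, mem_Ico, mem_erase]
      omega
    have h6 : ∏ j ∈ (Ico r (s + 1)).erase k, (ζ ^ k - ζ ^ j) ≠ 0 := prod_ne_zero_iff.2 fun j hj =>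
      sub_ne_zero.2 fun e => (mem_erase.1 hj).1 (hinj (mem_erase.1 hj).2 hk e.symm)
    rw [h5, ← eq_div_iff h6] at h4
    rw [h4, Lagrange.nodalWeight, prod_inv_distrib]
    ring
  rw [sum_congr rfl h3, ← mul_sum]
  have h7 := hne (mem_Ico.2 ⟨le_rfl, by omega⟩ : r ∈ Ico r (s + 1))
  have h8 := hne (mem_Ico.2 ⟨hrs.le, by omega⟩ : s ∈ Ico r (s + 1))
  rw [← mul_inv, eq_mul_inv_iff_mul_eq₀ (mul_ne_zero h7 h8)]
  linear_combination n * h1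

/-- `n` times the generating function `∑ P(a,b) x ^ a * y ^ b` at `x = ζ ^ r - 1`,
`y = ζ ^ s - 1`. -/
noncomputable def gridSum (n : ℕ) (ζ : ℂ) (r s : ℕ) : ℂ :=
  ∑ k ∈ Ico 1 n, (1 - ζ ^ k)⁻¹ *
    ((∏ i ∈ Ico 1 k, (ζ ^ r - ζ ^ i)) * ∏ i ∈ Ico (k + 1) n, (ζ ^ s - ζ ^ i))

lemma gridSum_of_lt {r s : ℕ} (hr : 1 ≤ r) (hrs : r < s) (hs : s < n) : gridSum n ζ r s = 0 := by
  refine sum_eq_zero fun k hk => mul_eq_zero_of_right _ ?_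
  rcases lt_or_ge r k with h | h
  · exact mul_eq_zero_of_left (prod_eq_zero (mem_Ico.2 ⟨hr, h⟩) (sub_self _)) _
  · exact mul_eq_zero_of_right _
      (prod_eq_zero (mem_Ico.2 ⟨by omega, hs⟩ : s ∈ Ico (k + 1) n) (sub_self _))

lemma gridSum_of_gt (hζ : IsPrimitiveRoot ζ n) {r s : ℕ} (hr : 1 ≤ r) (hrs : r < s)
    (hs : s < n) : gridSum n ζ s r = -n * ((1 - ζ ^ r)⁻¹ * (1 - ζ ^ s)⁻¹) := by
  rw [← sum_prod_mul_prod_mul_inv hζ hr hrs hs]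
  refine (sum_subset (Ico_subset_Ico hr hs) fun k hk hk' => mul_eq_zero_of_right _ ?_).symm
  rw [mem_Ico] at hk hk'
  rcases lt_or_ge s k with h | h
  · exact mul_eq_zero_of_left (prod_eq_zero (mem_Ico.2 ⟨hr.trans hrs.le, h⟩) (sub_self _)) _
  · exact mul_eq_zero_of_right _
      (prod_eq_zero (mem_Ico.2 ⟨by omega, by omega⟩ : r ∈ Ico (k + 1) n) (sub_self _))

lemma gridSum_self (hζ : IsPrimitiveRoot ζ n) {r : ℕ} (hr : 1 ≤ r) (hrn : r < n) :
    gridSum n ζ r r = -n * ((ζ ^ r)⁻¹ * (1 - ζ ^ r)⁻¹ ^ 2) := by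
  have h0 : ζ ^ r ≠ 0 := pow_ne_zero _ (hζ.ne_zero (by omega))
  have h1 := one_sub_pow_ne_zero hζ hr hrn
  have h2 := pow_mul_prod_pow_sub_pow hζ hr hrn
  rw [gridSum, sum_eq_single_of_mem r (mem_Ico.2 ⟨hr, hrn⟩), ← h2]
  · field_simp
    ring
  · intro k hk hkr
    refine mul_eq_zero_of_right _ ?_
    rcases hkr.lt_or_gt with h | h
    · exact mul_eq_zero_of_right _ (prod_eq_zero (mem_Ico.2 ⟨h, hrn⟩) (sub_self _))
    · exact mul_eq_zero_of_left (prod_eq_zero (mem_Ico.2 ⟨hr, h⟩) (sub_self _)) _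

lemma sum_prod_one_add_mul (hζ : IsPrimitiveRoot ζ n) (hn : 1 ≤ n) (u : ℕ → ℂ)
    (hu : ∀ k, u k = 1 / (1 - ζ ^ k)) (r s : ℕ) :
    n * ∑ k ∈ Ico 1 n, u k ^ 2 * (∏ i ∈ Ico 1 k, (1 + u i * (ζ ^ r - 1))) *
      ∏ i ∈ Ico (k + 1) n, (1 + u i * (ζ ^ s - 1)) = gridSum n ζ r s := by
  have hne {i : ℕ} (h : 1 ≤ i) (h' : i < n) := one_sub_pow_ne_zero hζ h h'
  have hprod (t a b : ℕ) (ha : 1 ≤ a) (hb : b ≤ n) :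
      (∏ i ∈ Ico a b, (1 - ζ ^ i)) * ∏ i ∈ Ico a b, (1 + u i * (ζ ^ t - 1)) =
        ∏ i ∈ Ico a b, (ζ ^ t - ζ ^ i) := by
    rw [← prod_mul_distrib]
    refine prod_congr rfl fun i hi => ?_
    have hi := mem_Ico.1 hi
    have := hne (ha.trans hi.1) (hi.2.trans_le hb)
    rw [hu]
    field_simp
    ring
  rw [gridSum, mul_sum]
  refine sum_congr rfl fun k hk => ?_
  have hk := mem_Ico.1 hk
  have hk0 := hne hk.1 hk.2
  rw [← prod_Ico_one_sub_pow hζ hn, ← prod_Ico_consecutive _ hk.1 hk.2.le,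
    prod_eq_prod_Ico_succ_bot hk.2, ← hprod r 1 k le_rfl hk.2.le,
    ← hprod s (k + 1) n (by omega) le_rfl, hu k, one_div]
  linear_combination (1 - ζ ^ k)⁻¹ * (∏ i ∈ Ico 1 k, (1 - ζ ^ i)) *
    (∏ i ∈ Ico (k + 1) n, (1 - ζ ^ i)) * (∏ i ∈ Ico 1 k, (1 + u i * (ζ ^ r - 1))) *
    (∏ i ∈ Ico (k + 1) n, (1 + u i * (ζ ^ s - 1))) * inv_mul_cancel₀ hk0

end

section
open Polynomial

/-- The polynomial whose coefficients are `n` times the values of the symmetric sums. -/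
noncomputable def symmPoly (n : ℕ) : ℂ[X] :=
  (((X - 1) * (1 + X) ^ n : ℂ[X]).divX).divX

lemma coeff_symmPoly (n m : ℕ) :
    (symmPoly n).coeff m = n.choose (m + 1) - n.choose (m + 2) := by
  rw [symmPoly, coeff_divX, coeff_divX, sub_mul, one_mul, coeff_sub, coeff_X_mul,
    coeff_one_add_X_pow, coeff_one_add_X_pow]

lemma natDegree_symmPoly_lt {n : ℕ} (hn : 1 ≤ n) : (symmPoly n).natDegree < n := by
  have h : ((X - 1) * (1 + X) ^ n : ℂ[X]).natDegree ≤ n + 1 := by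
    compute_degree
    omega
  rw [symmPoly, natDegree_divX_eq_natDegree_tsub_one, natDegree_divX_eq_natDegree_tsub_one]
  omega

lemma X_sq_mul_symmPoly (n : ℕ) :
    X ^ 2 * symmPoly n = (X - 1) * (1 + X) ^ n + 1 + C (n - 1 : ℂ) * X := by
  have h1 := divX_mul_X_add ((X - 1) * (1 + X) ^ n : ℂ[X])
  have h2 := divX_mul_X_add (((X - 1) * (1 + X) ^ n : ℂ[X]).divX)
  have h3 : ((X - 1) * (1 + X) ^ n : ℂ[X]).coeff 0 = -1 := by
    simp [coeff_zero_eq_eval_zero]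
  have h4 : ((X - 1) * (1 + X) ^ n : ℂ[X]).divX.coeff 0 = -(n - 1 : ℂ) := by
    rw [coeff_divX, sub_mul, one_mul, coeff_sub, coeff_X_mul, coeff_one_add_X_pow,
      coeff_one_add_X_pow]
    simp
  rw [h4, C_neg] at h2
  rw [h3, C_neg, C_1] at h1
  rw [symmPoly]
  linear_combination h1 + X * h2

variable {n : ℕ} {z : ℂ}

lemma eval_symmPoly (hz : z ^ n = 1) (hz1 : z ≠ 1) :
    (symmPoly n).eval (z - 1) = n * (z - 1)⁻¹ := by
  have h := congr_arg (eval (z - 1)) (X_sq_mul_symmPoly n)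
  simp only [eval_mul, eval_pow, eval_X, eval_add, eval_sub, eval_one, eval_C,
    add_sub_cancel, hz] at h
  have h0 := sub_ne_zero.2 hz1
  field_simp
  refine mul_left_cancel₀ h0 ?_
  linear_combination h

lemma eval_derivative_symmPoly (hn : 1 ≤ n) (hz : z ^ n = 1) (hz1 : z ≠ 1) :
    (derivative (symmPoly n)).eval (z - 1) = -2 * n * (z⁻¹ * (z - 1)⁻¹ ^ 2) := by
  have h := congr_arg (fun p => eval (z - 1) (derivative p)) (X_sq_mul_symmPoly n)
  have hp : z * z ^ (n - 1) = 1 := by rw [← pow_succ', Nat.sub_add_cancel hn, hz]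
  have hz0 : z ≠ 0 := left_ne_zero_of_mul_eq_one hp
  have h0 := sub_ne_zero.2 hz1
  simp only [derivative_mul, derivative_pow, derivative_add, derivative_sub, derivative_X,
    derivative_one, derivative_C, eval_mul, eval_pow, eval_X, eval_add, eval_sub, eval_one, eval_C,
    eval_zero, add_sub_cancel, eval_symmPoly hz hz1, hz, eq_inv_of_mul_eq_one_right hp] at h
  push_cast at h
  field_simp at h ⊢
  linear_combination h

/-- The divided difference of a polynomial, multiplied by `x - y`. -/
lemma sub_mul_sum_geom (p : ℂ[X]) {N : ℕ} (hN : p.natDegree < N) (x y : ℂ) :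
    (∑ j ∈ (range N).sigma range, p.coeff j.1 * x ^ j.2 * y ^ (j.1 - 1 - j.2)) * (x - y) =
      p.eval x - p.eval y := by
  rw [sum_sigma, eval_eq_sum_range' hN, eval_eq_sum_range' hN, ← sum_sub_distrib, sum_mul]
  refine sum_congr rfl fun m _ => ?_
  rw [← mul_sub, ← geom_sum₂_mul, ← mul_assoc, mul_sum]
  simp only [mul_assoc]

lemma sum_geom_self (p : ℂ[X]) {N : ℕ} (hN : p.natDegree < N) (x : ℂ) :
    ∑ j ∈ (range N).sigma range, p.coeff j.1 * x ^ j.2 * x ^ (j.1 - 1 - j.2) =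
      (derivative p).eval x := by
  rw [sum_sigma]
  conv_rhs => rw [as_sum_range' p N hN, derivative_sum, eval_finsetSum]
  refine sum_congr rfl fun m _ => ?_
  have h : ∀ i ∈ range m, p.coeff m * x ^ i * x ^ (m - 1 - i) = p.coeff m * x ^ (m - 1) := by
    intro i hi
    rw [mul_assoc, ← pow_add, Nat.add_sub_cancel' (by have := mem_range.1 hi; omega)]
  rw [sum_congr rfl h, sum_const, card_range, nsmul_eq_mul, derivative_monomial, eval_monomial]
  ring

lemma sum_coeff_sigma (c : ℕ → ℂ) {N : ℕ} (hc : ∀ m, N ≤ m → c m = 0) (a b : ℕ) :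
    ∑ j ∈ (range N).sigma range, (C (c j.1) * X ^ j.2 : ℂ[X]).coeff a *
      (X ^ (j.1 - 1 - j.2) : ℂ[X]).coeff b = c (a + b + 1) := by
  simp only [coeff_C_mul, coeff_X_pow]
  rw [sum_eq_single ⟨a + b + 1, a⟩]
  · simp
  · rintro ⟨m, i⟩ hj hne
    simp only [mem_sigma, mem_range] at hj
    by_cases h : a = i
    · subst h
      have : b ≠ m - 1 - a := fun h => hne (by rw [h]; congr; omega)
      simp [this]
    · simp [h]
  · intro h
    have : N ≤ a + b + 1 := by
      by_contra h'
      refine h (mem_sigma.2 ⟨mem_range.2 ?_, mem_range.2 ?_⟩) <;> dsimp only <;> omega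
    simp [hc _ this]

end

open Polynomial in
lemma degree_prod_one_add_lt (u : ℕ → ℂ) (s : Finset ℕ) {N : ℕ} (hs : #s < N) :
    (∏ i ∈ s, (1 + C (u i) * X)).degree < (N : WithBot ℕ) := by
  refine (degree_prod_le _ _).trans_lt (lt_of_le_of_lt (sum_le_card_nsmul s _ 1 fun i _ => ?_) ?_)
  · compute_degree
  · rw [nsmul_one]
    exact_mod_cast hs

open Polynomial in
lemma gridSum_add_gridSum {n : ℕ} {ζ : ℂ} (hζ : IsPrimitiveRoot ζ n) {r s : ℕ} (hr : 1 ≤ r)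
    (hrn : r < n) (hs : 1 ≤ s) (hsn : s < n) :
    gridSum n ζ r s + gridSum n ζ s r =
      ∑ j ∈ (range n).sigma range,
        (symmPoly n).coeff j.1 * (ζ ^ r - 1) ^ j.2 * (ζ ^ s - 1) ^ (j.1 - 1 - j.2) := by
  have hdeg := natDegree_symmPoly_lt (n := n) (by omega)
  have hpow (k : ℕ) : (ζ ^ k) ^ n = 1 := by rw [pow_right_comm, hζ.pow_eq_one, one_pow]
  have hne {k : ℕ} (h : 1 ≤ k) (h' : k < n) : ζ ^ k ≠ 1 :=
    hζ.pow_ne_one_of_pos_of_lt (by omega) h'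
  have hinv (k : ℕ) : (ζ ^ k - 1)⁻¹ = -(1 - ζ ^ k)⁻¹ := by rw [← neg_sub, inv_neg]
  rcases eq_or_ne r s with rfl | hrs
  · rw [sum_geom_self _ hdeg, eval_derivative_symmPoly (by omega) (hpow r) (hne hr hrn),
      gridSum_self hζ hr hrn, hinv]
    ring
  · have hsum : gridSum n ζ r s + gridSum n ζ s r =
        -n * ((1 - ζ ^ r)⁻¹ * (1 - ζ ^ s)⁻¹) := by
      rcases hrs.lt_or_gt with h | h
      · rw [gridSum_of_lt hr h hsn, gridSum_of_gt hζ hr h hsn, zero_add]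
      · rw [gridSum_of_lt hs h hrn, gridSum_of_gt hζ hs h hrn, add_zero,
          mul_comm (1 - ζ ^ s)⁻¹]
    have hsub : (ζ ^ r - 1) - (ζ ^ s - 1) ≠ 0 := fun e =>
      hrs (hζ.pow_inj hrn hsn (by linear_combination e))
    refine mul_right_cancel₀ hsub ?_
    rw [sub_mul_sum_geom _ hdeg, eval_symmPoly (hpow r) (hne hr hrn),
      eval_symmPoly (hpow s) (hne hs hsn), hsum, hinv, hinv]
    have h1 := one_sub_pow_ne_zero hζ hr hrn
    have h2 := one_sub_pow_ne_zero hζ hs hsn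
    field_simp
    ring

open Polynomial in
lemma sum_coeff_add_sum_coeff {n : ℕ} {ζ : ℂ} (hζ : IsPrimitiveRoot ζ n) (hn : 1 ≤ n) (u : ℕ → ℂ)
    (hu : ∀ k, u k = 1 / (1 - ζ ^ k)) (a b : ℕ) :
    (n : ℂ) *
      (∑ k ∈ Ico 1 n, u k ^ 2 * (∏ i ∈ Ico 1 k, (1 + C (u i) * X)).coeff a *
          (∏ i ∈ Ico (k + 1) n, (1 + C (u i) * X)).coeff b +
        ∑ k ∈ Ico 1 n, u k ^ 2 * (∏ i ∈ Ico 1 k, (1 + C (u i) * X)).coeff b *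
          (∏ i ∈ Ico (k + 1) n, (1 + C (u i) * X)).coeff a) =
      n.choose (a + b + 2) - n.choose (a + b + 3) := by
  have hx : Set.InjOn (fun r => ζ ^ r - 1) (Ico 1 n : Finset ℕ) := fun r hr s hs h =>
    hζ.pow_inj (mem_Ico.1 hr).2 (mem_Ico.1 hs).2 (sub_left_injective h)
  have hC (c : ℂ) {p : ℂ[X]} (hp : p.degree < #(Ico 1 n)) : (C c * p).degree < #(Ico 1 n) := by
    refine lt_of_le_of_lt ?_ hp
    rw [← smul_eq_C_mul]
    exact degree_smul_le c p
  have hX {i : ℕ} (hi : i + 1 < n) : (X ^ i : ℂ[X]).degree < #(Ico 1 n) := by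
    rw [degree_X_pow, Nat.card_Ico]
    exact_mod_cast Nat.lt_sub_of_add_lt hi
  have key := sum_coeff_mul_coeff_eq (fun r => ζ ^ r - 1) (Ico 1 n) hx (Ico 1 n)
    ((range n).sigma range) (fun k => C (n * u k ^ 2) * ∏ i ∈ Ico 1 k, (1 + C (u i) * X))
    (fun k => ∏ i ∈ Ico (k + 1) n, (1 + C (u i) * X))
    (fun j => C ((symmPoly n).coeff j.1) * X ^ j.2) (fun j => X ^ (j.1 - 1 - j.2)) ?_ ?_ ?_ ?_ ?_ a b
  · have hc (m : ℕ) (hm : n ≤ m) : (symmPoly n).coeff m = 0 :=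
      coeff_eq_zero_of_natDegree_lt ((natDegree_symmPoly_lt hn).trans_le hm)
    rw [sum_coeff_sigma _ hc, coeff_symmPoly] at key
    rw [← sum_add_distrib, mul_sum, ← key]
    refine sum_congr rfl fun k _ => ?_
    rw [coeff_C_mul, coeff_C_mul]
    ring
  · intro k hk
    have := mem_Ico.1 hk
    exact hC _ (degree_prod_one_add_lt _ _ (by simp only [Nat.card_Ico]; omega))
  · intro k hk
    have := mem_Ico.1 hk
    exact degree_prod_one_add_lt _ _ (by simp only [Nat.card_Ico]; omega)
  · intro j hj
    simp only [mem_sigma, mem_range] at hj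
    exact hC _ (hX (by omega))
  · intro j hj
    simp only [mem_sigma, mem_range] at hj
    exact hX (by omega)
  · intro r hr s hs
    rw [mem_Ico] at hr hs
    simp only [eval_mul, eval_C, eval_pow, eval_X, eval_prod, eval_add, eval_one]
    rw [← gridSum_add_gridSum hζ hr.1 hr.2 hs.1 hs.2, ← sum_prod_one_add_mul hζ hn u hu,
      ← sum_prod_one_add_mul hζ hn u hu, mul_sum, mul_sum, ← sum_add_distrib]
    exact sum_congr rfl fun k _ => by ring

lemma choose_sub_choose_eq {n : ℕ} (hn : 1 ≤ n) (m : ℕ) :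
    (n.choose (m + 1) : ℂ) - n.choose (m + 2) =
      n * (-((m.factorial : ℂ) * ((n : ℂ) - 2 * m - 3) / ((m + 2).factorial : ℂ)) *
        ((n - 1).choose m : ℂ)) := by
  obtain ⟨N, rfl⟩ := Nat.exists_eq_add_of_le' hn
  have h1 : ((N + 1 : ℕ) : ℂ) * N.choose m = (N + 1).choose (m + 1) * (m + 1 : ℕ) := by
    exact_mod_cast Nat.add_one_mul_choose_eq N m
  have h2 : ((N + 1).choose (m + 2) : ℂ) * (m + 2) = (N + 1).choose (m + 1) * (N - m) := by
    have h := Nat.choose_succ_right_eq (N + 1) (m + 1)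
    rcases le_or_gt m N with h' | h'
    · rw [Nat.add_sub_add_right] at h
      rw [← Nat.cast_sub h']
      exact_mod_cast h
    · simp [Nat.choose_eq_zero_of_lt (show N + 1 < m + 1 by omega),
        Nat.choose_eq_zero_of_lt (show N + 1 < m + 2 by omega)]
  have h3 : (m.factorial : ℂ) ≠ 0 := by exact_mod_cast m.factorial_ne_zero
  have h4 : (m + 1 : ℂ) ≠ 0 := by exact_mod_cast m.succ_ne_zero
  have h5 : (m + 2 : ℂ) ≠ 0 := by exact_mod_cast (m + 1).succ_ne_zero
  rw [Nat.add_sub_cancel, Nat.factorial_succ, Nat.factorial_succ]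
  push_cast at h1 ⊢
  rw [add_assoc (m : ℂ) 1 1, one_add_one_eq_two]
  field_simp
  linear_combination (N + 1 - 2 * m - 3) * h1 - (m + 1) * h2

theorem qmzv_one_two_symmetric (n m a b : ℕ) (hn : 2 ≤ n)
    (hm : m = a + b + 1) (hm2 : 2 ≤ m)
    (ζ : ℂ) (hζ : ζ = Complex.exp (2 * Real.pi * Complex.I / n))
    (u : ℕ → ℂ) (hu : ∀ k, u k = 1 / (1 - ζ ^ k)) :
    ((∑ i ∈ (Fintype.piFinset fun _ : Fin m => Finset.Icc 1 (n - 1)).filter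
          (fun i => StrictMono i),
        ∏ r, u (i r) ^ (if (r : ℕ) = a then 2 else 1)) +
      ∑ i ∈ (Fintype.piFinset fun _ : Fin m => Finset.Icc 1 (n - 1)).filter
          (fun i => StrictMono i),
        ∏ r, u (i r) ^ (if (r : ℕ) = b then 2 else 1)) =
      -((m.factorial : ℂ) * ((n : ℂ) - 2 * m - 3) / ((m + 2).factorial : ℂ)) *
        (Nat.choose (n - 1) m : ℂ) := by
  have hζ' : IsPrimitiveRoot ζ n := hζ ▸ Complex.isPrimitiveRoot_exp n (by omega)
  have hN : n - 1 + 1 = n := by omega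
  have hn0 : (n : ℂ) ≠ 0 := by exact_mod_cast (by omega : n ≠ 0)
  have ha := strictMonoSum_eq_sum_coeff u a b (n - 1)
  have hb := strictMonoSum_eq_sum_coeff u b a (n - 1)
  rw [add_comm b a, hN, ← hm] at hb
  rw [hN, ← hm] at ha
  refine mul_left_cancel₀ hn0 ?_
  rw [← choose_sub_choose_eq (by omega) m]
  have h := sum_coeff_add_sum_coeff hζ' (by omega) u hu a b
  rw [← ha, ← hb] at h
  subst hm
  exact h
end

section
/- Let n ≥ 2, ζ = exp(2πi/n), u a positive integer, and let S_{2u}(n) = Σ_{r=1}^{n-1} cot^{2u}(rπ/n). Then S_{2u}(n) = (-1)^u n - (-1)^u 2^{2u} Σ n^{2j₀} ∏_{r=0}^{2u} B_{2j_r}/(2j_r)!, where the sum is over tuples (j₀,…,j_{2u}) of nonnegative integers with j₀+j₁+⋯+j_{2u} = u, and B_k are Bernoulli numbers. In particular, S_{2u}(n) is a polynomial in n of degree 2u with rational coefficients. -/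
open Finset Real

namespace PowerSeries

theorem coeff_prod_fin {R : Type*} [CommSemiring R] {k : ℕ} (f : Fin k → PowerSeries R) (n : ℕ) :
    coeff n (∏ i, f i) =
      ∑ j ∈ Finset.Nat.antidiagonalTuple k n, ∏ i, coeff (j i) (f i) := by
  rw [coeff_prod]
  refine Finset.sum_equiv Finsupp.equivFunOnFinite (fun j => ?_) (fun j _ => rfl)
  simp [Finset.Nat.mem_antidiagonalTuple, Finset.mem_finsuppAntidiag]

section Riccati

variable {K : Type*} [Field K] [CharZero K]

/-- If `f = X * coth X`, then `coeff p (f ^ (p + 1))` is the residue of `coth ^ (p + 1)`. -/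
theorem coeff_pow_succ_of_riccati {f : PowerSeries K} (h0 : constantCoeff f = 1)
    (hf : X * derivative K f = f + X ^ 2 - f ^ 2) (p : ℕ) :
    coeff p (f ^ (p + 1)) = if Even p then 1 else 0 := by
  induction p using Nat.twoStepInduction with
  | zero => simp [h0]
  | one =>
    have h : f ^ 2 = f + X ^ 2 - X * derivative K f := by linear_combination hf
    have hX : coeff 1 (X ^ 2 : PowerSeries K) = 0 := by simp [coeff_X_pow]
    have hD : coeff (0 + 1) (X * derivative K f) = coeff 1 f := by
      rw [coeff_succ_X_mul, coeff_derivative]; simp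
    simp only [zero_add] at hD
    simp [h, hX, hD]
  | more p ih _ =>
    have hp : ((p : K) + 2) ≠ 0 := by exact_mod_cast (show p + 2 ≠ 0 by omega)
    have h : C ((p : K) + 2) * f ^ (p + 3) = C ((p : K) + 2) * (f ^ (p + 2) + X ^ 2 * f ^ (p + 1))
        - X * derivative K (f ^ (p + 2)) := by
      rw [derivative_pow]
      have hC : C ((p : K) + 2) = ((p + 2 : ℕ) : PowerSeries K) := by
        simpa using map_ofNat C 2
      rw [hC, show p + 2 - 1 = p + 1 by omega]
      linear_combination ((p + 2 : ℕ) : PowerSeries K) * f ^ (p + 1) * hf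
    have hc := congrArg (coeff (p + 2)) h
    rw [map_sub, coeff_C_mul, coeff_C_mul, map_add, coeff_X_pow_mul,
      show coeff (p + 2) (X * derivative K (f ^ (p + 2))) = _ from coeff_succ_X_mul (p + 1) _,
      coeff_derivative, ih] at hc
    have : coeff (p + 2) (f ^ (p + 3)) = if Even p then 1 else 0 := by
      apply mul_left_cancel₀ hp
      rw [hc]
      push_cast
      ring
    rw [this]
    simp [Nat.even_add]

/-- If `f = X * coth X` and `g = X * coth (X + a)` with `d = coth a`, this computes the residue of
`coth X ^ m * coth (X + a)` for `m` even and odd. -/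
theorem coeff_pow_mul_of_riccati {f g : PowerSeries K} {d : K} (h0 : constantCoeff f = 1)
    (hf : X * derivative K f = f + X ^ 2 - f ^ 2) (hg : g * (f + C d * X) = X * (X + C d * f))
    (k : ℕ) :
    coeff (2 * k) (f ^ (2 * k) * g) = 1 - d ^ (2 * k) ∧
      coeff (2 * k + 1) (f ^ (2 * k + 1) * g) = d ^ (2 * k + 1) := by
  have step (m : ℕ) : coeff (m + 1) (f ^ (m + 1) * g) = coeff m (X * f ^ m) +
      d * (if Even m then 1 else 0) - d * coeff m (f ^ m * g) := by
    have h : f ^ (m + 1) * g = X * (X * f ^ m + C d * f ^ (m + 1) - C d * (f ^ m * g)) := by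
      linear_combination f ^ m * hg
    rw [h, coeff_succ_X_mul, map_sub, map_add, coeff_C_mul, coeff_C_mul,
      coeff_pow_succ_of_riccati h0 hf]
  have odd_of_even (k : ℕ) (h : coeff (2 * k) (f ^ (2 * k) * g) = 1 - d ^ (2 * k)) :
      coeff (2 * k + 1) (f ^ (2 * k + 1) * g) = d ^ (2 * k + 1) := by
    have hX : coeff (2 * k) (X * f ^ (2 * k)) = 0 := by
      rcases k with _ | k
      · simp
      · rw [show 2 * (k + 1) = 2 * k + 1 + 1 by ring, coeff_succ_X_mul,
          coeff_pow_succ_of_riccati h0 hf, if_neg (by simp)]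
    rw [step, h, hX, if_pos (by simp)]
    ring
  induction k with
  | zero =>
    have h : coeff (2 * 0) (f ^ (2 * 0) * g) = 1 - d ^ (2 * 0) := by
      have := congrArg constantCoeff hg
      simpa [h0] using this
    exact ⟨h, odd_of_even 0 h⟩
  | succ k ih =>
    have h : coeff (2 * (k + 1)) (f ^ (2 * (k + 1)) * g) = 1 - d ^ (2 * (k + 1)) := by
      rw [show 2 * (k + 1) = 2 * k + 1 + 1 by ring, step, ih.2, coeff_succ_X_mul,
        coeff_pow_succ_of_riccati h0 hf, if_pos (by simp), if_neg (by simp)]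
      ring
    exact ⟨h, odd_of_even _ h⟩

end Riccati

section Coth

variable (K : Type*) [Field K] [CharZero K]

/-- The power series of `√X * coth √X`. -/
noncomputable def sqrtMulCoth : PowerSeries K :=
  mk fun k => 4 ^ k * ((bernoulli (2 * k) : K) / (2 * k).factorial)

/-- The power series of `X * coth X`. -/
noncomputable def mulCoth : PowerSeries K :=
  expand 2 two_ne_zero (sqrtMulCoth K)

/-- The power series of `exp (2 * X)`. -/
noncomputable def expTwo : PowerSeries K :=
  rescale 2 (exp K)

theorem mulCoth_eq : mulCoth K = rescale 2 (bernoulliPowerSeries K) + X := by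
  ext n
  rw [mulCoth, map_add, coeff_rescale, bernoulliPowerSeries, coeff_mk]
  rcases Nat.even_or_odd' n with ⟨k, rfl | rfl⟩
  · rw [coeff_expand_mul, sqrtMulCoth, coeff_mk, coeff_X, if_neg (by omega), pow_mul]
    norm_num
  · rw [coeff_expand_of_not_dvd _ _ _ (by omega), coeff_X]
    rcases k with _ | k
    · norm_num
    · rw [bernoulli_eq_zero_of_odd (by simp) (by omega), if_neg (by omega)]
      simp

theorem constantCoeff_mulCoth : constantCoeff (mulCoth K) = 1 := by
  rw [mulCoth, constantCoeff_expand, ← coeff_zero_eq_constantCoeff_apply, sqrtMulCoth, coeff_mk]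
  simp

theorem constantCoeff_expTwo : constantCoeff (expTwo K) = 1 := by
  rw [expTwo, ← coeff_zero_eq_constantCoeff_apply, coeff_rescale]
  simp

theorem coeff_expTwo (m : ℕ) : coeff m (expTwo K) = 2 ^ m / m.factorial := by
  rw [expTwo, coeff_rescale, coeff_exp]
  simp [div_eq_mul_inv]

theorem expTwo_pow_sub_one_ne_zero {n : ℕ} (hn : n ≠ 0) : expTwo K ^ n - 1 ≠ 0 := by
  intro h
  have h1 := congrArg (coeff 1) h
  rw [expTwo, ← map_pow, exp_pow_eq_rescale_exp, map_sub, coeff_rescale, coeff_rescale,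
    coeff_exp] at h1
  simp [coeff_one, hn] at h1

theorem expTwo_sub_one_ne_zero : expTwo K - 1 ≠ 0 := by
  simpa using expTwo_pow_sub_one_ne_zero K one_ne_zero

theorem derivative_expTwo : derivative K (expTwo K) = 2 * expTwo K := by
  ext m
  rw [coeff_derivative, show (2 : PowerSeries K) = C (2 : K) from (map_ofNat C 2).symm, coeff_C_mul, coeff_expTwo,
    coeff_expTwo, Nat.factorial_succ]
  have h1 : ((m : K) + 1) ≠ 0 := by exact_mod_cast m.succ_ne_zero
  have h2 : (m.factorial : K) ≠ 0 := by exact_mod_cast m.factorial_ne_zero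
  push_cast
  field_simp
  ring

theorem mulCoth_mul_expTwo_sub_one :
    mulCoth K * (expTwo K - 1) = X * (expTwo K + 1) := by
  have h := congrArg (rescale (2 : K)) (bernoulliPowerSeries_mul_exp_sub_one K)
  rw [map_mul, map_sub, map_one, rescale_X] at h
  rw [mulCoth_eq, expTwo]
  have h2 : C (2 : K) = (2 : PowerSeries K) := map_ofNat C 2
  rw [h2] at h
  linear_combination h

theorem X_mul_derivative_mulCoth :
    X * derivative K (mulCoth K) = mulCoth K + X ^ 2 - mulCoth K ^ 2 := by
  have h1 := mulCoth_mul_expTwo_sub_one K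
  have h2 := congrArg (derivative K) h1
  simp only [Derivation.leibniz, map_sub, map_add, derivative_expTwo, derivative_X, derivative_one,
    smul_eq_mul] at h2
  refine mul_left_cancel₀ (pow_ne_zero 2 (expTwo_sub_one_ne_zero K)) ?_
  linear_combination X * (expTwo K - 1) * h2 + (mulCoth K * (expTwo K - 1) + X * (expTwo K + 1)
    - (expTwo K - 1) - 2 * X * expTwo K) * h1

variable {K}

/-- The addition formula for `coth`, cleared of denominators. -/
theorem mul_mulCoth_add {g : PowerSeries K} {w : K} (hw : w ≠ 1)
    (hg : g * (C w * expTwo K - 1) = X * (C w * expTwo K + 1)) :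
    g * (mulCoth K + C ((w + 1) / (w - 1)) * X) =
      X * (X + C ((w + 1) / (w - 1)) * mulCoth K) := by
  have hw' : w - 1 ≠ 0 := sub_ne_zero.mpr hw
  have hd : C ((w + 1) / (w - 1)) * (C w - 1) = (C w + 1 : PowerSeries K) := by
    rw [← map_one (C (R := K)), ← map_sub, ← map_mul, ← map_add, div_mul_cancel₀ _ hw']
  have h1 := mulCoth_mul_expTwo_sub_one K
  have hC : (C w - 1 : PowerSeries K) ≠ 0 := by
    intro h
    exact hw' (by simpa using congrArg constantCoeff h)
  have hE : C w * expTwo K - 1 ≠ 0 := by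
    intro h
    exact hw' (by simpa [constantCoeff_expTwo] using congrArg constantCoeff h)
  refine mul_left_cancel₀ (mul_ne_zero (mul_ne_zero hE (expTwo_sub_one_ne_zero K)) hC) ?_
  generalize C ((w + 1) / (w - 1)) = d at *
  generalize (C w : PowerSeries K) = v at *
  generalize expTwo K = E at *
  generalize mulCoth K = H at *
  linear_combination (E - 1) * (v - 1) * (H + d * X) * hg
    + ((v - 1) * X * (v * E + 1) - (v * E - 1) * (v - 1) * X * d) * h1
    + (X ^ 2 * (v * E + 1) * (E - 1) - X ^ 2 * (v * E - 1) * (E + 1)) * hd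

/-- The multiplication formula for `coth`: the series `g r` stands for `X * coth (X + π i r / n)`. -/
theorem sum_eq_rescale_mulCoth {n : ℕ} (hn : 1 < n) {ζ : K} (hζ : IsPrimitiveRoot ζ n)
    (g : ℕ → PowerSeries K)
    (hg : ∀ r, g r * (C (ζ ^ r) * expTwo K - 1) = X * (C (ζ ^ r) * expTwo K + 1)) :
    ∑ r ∈ range n, g r = rescale (n : K) (mulCoth K) := by
  have hn0 : n ≠ 0 := by omega
  have hEn : rescale (n : K) (expTwo K) = expTwo K ^ n := by
    rw [expTwo, ← map_pow, exp_pow_eq_rescale_exp, rescale_rescale, rescale_rescale, mul_comm]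
  have hH := congrArg (rescale (n : K)) (mulCoth_mul_expTwo_sub_one K)
  simp only [map_mul, map_sub, map_add, map_one, hEn, rescale_X] at hH
  refine mul_right_cancel₀ (expTwo_pow_sub_one_ne_zero K hn0) ?_
  rw [hH, Finset.sum_mul]
  have hgr (r : ℕ) : g r * (expTwo K ^ n - 1) =
      X * ∑ k ∈ range n, (C ((ζ ^ k) ^ r) * expTwo K ^ k
        + C ((ζ ^ (k + 1)) ^ r) * expTwo K ^ (k + 1)) := by
    have hpow : expTwo K ^ n = (C (ζ ^ r) * expTwo K) ^ n := by
      rw [mul_pow, ← map_pow, pow_right_comm, hζ.pow_eq_one]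
      simp
    have hterm (k : ℕ) : C ((ζ ^ k) ^ r) * expTwo K ^ k = (C (ζ ^ r) * expTwo K) ^ k := by
      rw [mul_pow, ← map_pow, pow_right_comm]
    simp only [hterm]
    have hs : ∑ k ∈ range n, ((C (ζ ^ r) * expTwo K) ^ k + (C (ζ ^ r) * expTwo K) ^ (k + 1)) =
        (C (ζ ^ r) * expTwo K + 1) * ∑ k ∈ range n, (C (ζ ^ r) * expTwo K) ^ k := by
      rw [Finset.mul_sum]
      exact Finset.sum_congr rfl fun k _ => by ring
    rw [hs, hpow, ← mul_geom_sum]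
    linear_combination (∑ k ∈ range n, (C (ζ ^ r) * expTwo K) ^ k) * hg r
  have horth {k : ℕ} (hk : ¬ n ∣ k) : ∑ r ∈ range n, (ζ ^ k) ^ r = 0 := by
    have h1 : ζ ^ k - 1 ≠ 0 := sub_ne_zero.mpr fun h => hk ((hζ.pow_eq_one_iff_dvd k).mp h)
    refine mul_left_cancel₀ h1 ?_
    rw [mul_geom_sum, pow_right_comm, hζ.pow_eq_one]
    simp
  have hlow : ∑ k ∈ range n, C (∑ r ∈ range n, (ζ ^ k) ^ r) * expTwo K ^ k = C (n : K) := by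
    rw [Finset.sum_eq_single_of_mem 0 (by simp; omega)]
    · simp
    · intro k hk hk'
      rw [mem_range] at hk
      rw [horth (fun h => by have := Nat.le_of_dvd (by omega) h; omega), map_zero, zero_mul]
  have hhigh : ∑ k ∈ range n, C (∑ r ∈ range n, (ζ ^ (k + 1)) ^ r) * expTwo K ^ (k + 1) =
      C (n : K) * expTwo K ^ n := by
    rw [Finset.sum_eq_single_of_mem (n - 1) (by simp; omega)]
    · rw [show n - 1 + 1 = n by omega, hζ.pow_eq_one]
      simp
    · intro k hk hk'
      rw [mem_range] at hk
      rw [horth (fun h => by have := Nat.le_of_dvd (by omega) h; omega), map_zero, zero_mul]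
  simp only [hgr]
  rw [← Finset.mul_sum, Finset.sum_comm]
  simp only [Finset.sum_add_distrib, ← Finset.sum_mul, ← map_sum]
  rw [hlow, hhigh]
  ring

theorem coeff_mulCoth_pow_mul_rescale {n : ℕ} (hn : 1 < n) {ζ : K} (hζ : IsPrimitiveRoot ζ n)
    (u : ℕ) :
    coeff (2 * u) (mulCoth K ^ (2 * u) * rescale (n : K) (mulCoth K)) =
      n - ∑ r ∈ Finset.Icc 1 (n - 1), ((ζ ^ r + 1) / (ζ ^ r - 1)) ^ (2 * u) := by
  have hne {r : ℕ} (hr : r ∈ Finset.Icc 1 (n - 1)) : ζ ^ r ≠ 1 := by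
    rw [Finset.mem_Icc] at hr
    exact hζ.pow_ne_one_of_pos_of_lt (by omega) (by omega)
  have hex (r : ℕ) : ∃ g, g * (C (ζ ^ r) * expTwo K - 1) = X * (C (ζ ^ r) * expTwo K + 1) := by
    by_cases h : ζ ^ r = 1
    · exact ⟨mulCoth K, by simpa [h] using mulCoth_mul_expTwo_sub_one K⟩
    · refine ⟨X * (C (ζ ^ r) * expTwo K + 1) * (C (ζ ^ r) * expTwo K - 1)⁻¹, ?_⟩
      rw [mul_assoc, PowerSeries.inv_mul_cancel, mul_one]
      simpa [constantCoeff_expTwo, -map_pow] using sub_ne_zero.mpr h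
  choose g hg using hex
  have hg0 : g 0 = mulCoth K := by
    refine mul_right_cancel₀ (expTwo_sub_one_ne_zero K) ?_
    rw [mulCoth_mul_expTwo_sub_one]
    simpa using hg 0
  have hrange : range n = insert 0 (Finset.Icc 1 (n - 1)) := by
    ext r
    simp only [mem_range, mem_insert, Finset.mem_Icc]
    omega
  rw [← sum_eq_rescale_mulCoth hn hζ g hg, hrange, Finset.sum_insert (by simp), hg0, mul_add,
    ← pow_succ, map_add, coeff_pow_succ_of_riccati (constantCoeff_mulCoth K)
      (X_mul_derivative_mulCoth K), if_pos (by simp), Finset.mul_sum, map_sum,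
    Finset.sum_congr rfl fun r hr => (coeff_pow_mul_of_riccati (constantCoeff_mulCoth K)
      (X_mul_derivative_mulCoth K) (mul_mulCoth_add (hne hr) (hg r)) u).1,
    Finset.sum_sub_distrib]
  simp only [Finset.sum_const, Nat.card_Icc, nsmul_eq_mul, mul_one]
  rw [show n - 1 + 1 - 1 = n - 1 by omega, Nat.cast_sub hn.le]
  push_cast
  ring

theorem coeff_mulCoth_pow_mul_rescale_eq_sum (n u : ℕ) :
    coeff (2 * u) (mulCoth K ^ (2 * u) * rescale (n : K) (mulCoth K)) =
      2 ^ (2 * u) * ∑ j ∈ Finset.Nat.antidiagonalTuple (2 * u + 1) u,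
        (n : K) ^ (2 * j 0) *
          ∏ r : Fin (2 * u + 1), ((bernoulli (2 * j r) : K) / (2 * j r).factorial) := by
  have hr : rescale (n : K) (mulCoth K) =
      expand 2 two_ne_zero (rescale ((n : K) ^ 2) (sqrtMulCoth K)) := by
    ext m
    rw [coeff_rescale, mulCoth, coeff_expand, coeff_expand]
    split_ifs with h
    · obtain ⟨k, rfl⟩ := h
      rw [Nat.mul_div_cancel_left _ two_pos, coeff_rescale, pow_mul]
    · simp
  rw [hr, mulCoth, ← map_pow, ← map_mul, coeff_expand_mul, mul_comm]
  have hprod : rescale ((n : K) ^ 2) (sqrtMulCoth K) * sqrtMulCoth K ^ (2 * u) =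
      ∏ i : Fin (2 * u + 1), (Fin.cons (rescale ((n : K) ^ 2) (sqrtMulCoth K))
        (fun _ => sqrtMulCoth K) : Fin (2 * u + 1) → PowerSeries K) i := by
    simp [Fin.prod_univ_succ]
  rw [hprod, coeff_prod_fin, Finset.mul_sum]
  refine Finset.sum_congr rfl fun j hj => ?_
  rw [Finset.Nat.mem_antidiagonalTuple] at hj
  have h4 : (2 : K) ^ (2 * u) = ∏ r : Fin (2 * u + 1), 4 ^ j r := by
    rw [Finset.prod_pow_eq_pow_sum, hj, pow_mul]
    norm_num
  rw [h4, mul_left_comm, ← Finset.prod_mul_distrib, Fin.prod_univ_succ, Fin.prod_univ_succ]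
  simp only [Fin.cons_zero, Fin.cons_succ, coeff_rescale, sqrtMulCoth, coeff_mk, pow_mul]
  ring

end Coth

end PowerSeries

theorem Complex.exp_two_mul_add_one_div_sub_one {x : ℂ} (hx : Complex.sin x ≠ 0) :
    (Complex.exp (2 * x * Complex.I) + 1) / (Complex.exp (2 * x * Complex.I) - 1) =
      -Complex.I * (Complex.cos x / Complex.sin x) := by
  have h1 : Complex.exp (2 * x * Complex.I) =
      (Complex.cos x + Complex.sin x * Complex.I) ^ 2 := by
    rw [← Complex.exp_mul_I, ← Complex.exp_nat_mul]
    congr 1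
    push_cast
    ring
  have h2 : Complex.cos x + Complex.sin x * Complex.I ≠ 0 := by
    rw [← Complex.exp_mul_I]
    exact Complex.exp_ne_zero _
  have hs := Complex.sin_sq_add_cos_sq x
  have h3 : Complex.exp (2 * x * Complex.I) + 1 =
      2 * Complex.cos x * (Complex.cos x + Complex.sin x * Complex.I) := by
    rw [h1]
    linear_combination -hs + Complex.sin x ^ 2 * Complex.I_sq
  have h4 : Complex.exp (2 * x * Complex.I) - 1 =
      2 * Complex.I * Complex.sin x * (Complex.cos x + Complex.sin x * Complex.I) := by
    rw [h1]
    linear_combination hs - Complex.sin x ^ 2 * Complex.I_sq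
  rw [h3, h4]
  field_simp
  linear_combination Complex.cos x * Complex.I_sq

theorem cot_even_power_sum (n : ℕ) (hn : 2 ≤ n) (u : ℕ) (hu : 1 ≤ u) :
    ∑ r ∈ Finset.Icc 1 (n - 1),
        (Real.cos (r * Real.pi / n) / Real.sin (r * Real.pi / n)) ^ (2 * u) =
      (-1 : ℝ) ^ u * n -
        (-1 : ℝ) ^ u * 2 ^ (2 * u) *
          ∑ j ∈ Finset.Nat.antidiagonalTuple (2 * u + 1) u,
            (n : ℝ) ^ (2 * j 0) *
              ∏ r : Fin (2 * u + 1), ((bernoulli (2 * j r) : ℝ) / (2 * j r).factorial) := by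
  have hn0 : (n : ℝ) ≠ 0 := by exact_mod_cast (show n ≠ 0 by omega)
  have hnpos : (0 : ℝ) < n := by exact_mod_cast (show 0 < n by omega)
  have hmain := (PowerSeries.coeff_mulCoth_pow_mul_rescale_eq_sum (K := ℂ) n u).symm.trans
    (PowerSeries.coeff_mulCoth_pow_mul_rescale (by omega)
      (Complex.isPrimitiveRoot_exp n (by omega)) u)
  have hterm : ∀ r ∈ Finset.Icc 1 (n - 1),
      ((Complex.exp (2 * Real.pi * Complex.I / n) ^ r + 1) /
        (Complex.exp (2 * Real.pi * Complex.I / n) ^ r - 1)) ^ (2 * u) = (-1) ^ u *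
      (((Real.cos (r * Real.pi / n) / Real.sin (r * Real.pi / n)) ^ (2 * u) : ℝ) : ℂ) := by
    intro r hr
    rw [Finset.mem_Icc] at hr
    have hr0 : (0 : ℝ) < r := by exact_mod_cast hr.1
    have hrn : (r : ℝ) < n := by exact_mod_cast (show r < n by omega)
    have hsin : 0 < Real.sin (r * Real.pi / n) := by
      refine Real.sin_pos_of_pos_of_lt_pi (by positivity) ?_
      rw [div_lt_iff₀ hnpos]
      nlinarith [Real.pi_pos]
    have hexp : Complex.exp (2 * Real.pi * Complex.I / n) ^ r =
        Complex.exp (2 * ((r * Real.pi / n : ℝ) : ℂ) * Complex.I) := by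
      rw [← Complex.exp_nat_mul]
      congr 1
      push_cast
      ring
    rw [hexp, Complex.exp_two_mul_add_one_div_sub_one (by exact_mod_cast hsin.ne'), mul_pow,
      pow_mul (-Complex.I), neg_sq, Complex.I_sq]
    push_cast
    rfl
  rw [Finset.sum_congr rfl hterm, ← Finset.mul_sum] at hmain
  have hreal : (2 : ℝ) ^ (2 * u) * ∑ j ∈ Finset.Nat.antidiagonalTuple (2 * u + 1) u,
      (n : ℝ) ^ (2 * j 0) *
        ∏ r : Fin (2 * u + 1), ((bernoulli (2 * j r) : ℝ) / (2 * j r).factorial) =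
      n - (-1) ^ u * ∑ r ∈ Finset.Icc 1 (n - 1),
        (Real.cos (r * Real.pi / n) / Real.sin (r * Real.pi / n)) ^ (2 * u) := by
    exact_mod_cast hmain
  have hsign : ((-1 : ℝ) ^ u) * (-1) ^ u = 1 := by
    rw [← mul_pow]
    simp
  rw [mul_assoc ((-1 : ℝ) ^ u), hreal]
  linear_combination -(∑ r ∈ Finset.Icc 1 (n - 1),
    (Real.cos (r * Real.pi / n) / Real.sin (r * Real.pi / n)) ^ (2 * u)) * hsign
end
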